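/- arXiv:1909.08372 — 3 statements merged into one kernel-verified Lean document; each statement's English description precedes it below -/
import Mathlib

section
/- The family {x^i y^j : i, j = 0, 1, 2, ...} of elements of R is a k-basis of R; that is, these monomials are linearly independent over k and span R as a k-vector space. -/
/-!
`R = k⟨x,y⟩/⟨yx − 1⟩` is the associative `k`-algebra generated by `x` and `y`
with the single defining relation `y * x = 1` (the one-sided inverse of `k[x]`).
We realize it as the `RingQuot` of the free algebra on two generators.
-/

noncomputable section

/-- The defining relation `y * x = 1` on the free algebra `k⟨x,y⟩`. -/
inductive PreRel (k : Type) [Field k] : FreeAlgebra k (Fin 2) → FreeAlgebra k (Fin 2) → Prop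
  | yx : PreRel k (FreeAlgebra.ι k 1 * FreeAlgebra.ι k 0) 1

/-- `R = k⟨x,y⟩/⟨yx − 1⟩`. -/
abbrev R (k : Type) [Field k] := RingQuot (PreRel k)

/-- The generator `x` of `R`. -/
def Xg (k : Type) [Field k] : R k := RingQuot.mkAlgHom k (PreRel k) (FreeAlgebra.ι k 0)

/-- The generator `y` of `R`. -/
def Yg (k : Type) [Field k] : R k := RingQuot.mkAlgHom k (PreRel k) (FreeAlgebra.ι k 1)

/-- Action of `x` on exponents of normal monomials. -/
def xAct (p : ℕ × ℕ) : ℕ × ℕ := (p.1 + 1, p.2)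

/-- Action of `y` on exponents of normal monomials. -/
def yAct : ℕ × ℕ → ℕ × ℕ
  | (0, j) => (0, j + 1)
  | (i + 1, j) => (i, j)

/-- The left regular representation on the free module on normal monomials. -/
def preRep (k : Type) [Field k] : FreeAlgebra k (Fin 2) →ₐ[k] Module.End k ((ℕ × ℕ) →₀ k) :=
  FreeAlgebra.lift k ![Finsupp.lmapDomain k k xAct, Finsupp.lmapDomain k k yAct]

/-- The representation of `R`. -/
def rep (k : Type) [Field k] : R k →ₐ[k] Module.End k ((ℕ × ℕ) →₀ k) :=
  RingQuot.liftAlgHom k ⟨preRep k, by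
    intro a b h
    cases h
    rw [map_mul, map_one]
    apply Finsupp.lhom_ext
    intro p c
    simp [preRep, Finsupp.mapDomain_single, xAct, yAct]⟩

lemma rep_X (k : Type) [Field k] (p : ℕ × ℕ) (c : k) :
    rep k (Xg k) (Finsupp.single p c) = Finsupp.single (xAct p) c := by
  simp [rep, Xg, preRep, Finsupp.mapDomain_single]

lemma rep_Y (k : Type) [Field k] (p : ℕ × ℕ) (c : k) :
    rep k (Yg k) (Finsupp.single p c) = Finsupp.single (yAct p) c := by
  simp [rep, Yg, preRep, Finsupp.mapDomain_single]

lemma rep_Y_pow (k : Type) [Field k] (j : ℕ) :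
    rep k (Yg k ^ j) (Finsupp.single (0, 0) 1) = Finsupp.single (0, j) 1 := by
  induction j with
  | zero => simp
  | succ j ih => rw [pow_succ', map_mul, Module.End.mul_apply, ih, rep_Y]; rfl

lemma rep_X_pow (k : Type) [Field k] (i j : ℕ) :
    rep k (Xg k ^ i) (Finsupp.single (0, j) 1) = Finsupp.single (i, j) 1 := by
  induction i with
  | zero => simp
  | succ i ih => rw [pow_succ', map_mul, Module.End.mul_apply, ih, rep_X]; rfl

lemma Yg_mul_Xg (k : Type) [Field k] : Yg k * Xg k = 1 := by
  rw [Yg, Xg, ← map_mul, RingQuot.mkAlgHom_rel k PreRel.yx, map_one]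

lemma mul_mem_span_monomials (k : Type) [Field k] (a : FreeAlgebra k (Fin 2)) :
    ∀ s ∈ Submodule.span k (Set.range fun p : ℕ × ℕ => Xg k ^ p.1 * Yg k ^ p.2),
      RingQuot.mkAlgHom k (PreRel k) a * s ∈
        Submodule.span k (Set.range fun p : ℕ × ℕ => Xg k ^ p.1 * Yg k ^ p.2) := by
  induction a using FreeAlgebra.induction with
  | grade0 r =>
    intro s hs
    rw [AlgHom.commutes, ← Algebra.smul_def]
    exact Submodule.smul_mem _ _ hs
  | grade1 v =>
    intro s hs
    induction hs using Submodule.span_induction with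
    | mem s h =>
      obtain ⟨⟨i, j⟩, rfl⟩ := h
      apply Submodule.subset_span
      fin_cases v
      · refine ⟨(i + 1, j), ?_⟩
        change Xg k ^ (i + 1) * Yg k ^ j = Xg k * (Xg k ^ i * Yg k ^ j)
        rw [pow_succ', mul_assoc]
      · cases i with
        | zero =>
          refine ⟨(0, j + 1), ?_⟩
          change Xg k ^ 0 * Yg k ^ (j + 1) = Yg k * (Xg k ^ 0 * Yg k ^ j)
          rw [pow_zero, one_mul, one_mul, pow_succ']
        | succ i =>
          refine ⟨(i, j), ?_⟩
          change Xg k ^ i * Yg k ^ j = Yg k * (Xg k ^ (i + 1) * Yg k ^ j)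
          rw [pow_succ', ← mul_assoc, ← mul_assoc, Yg_mul_Xg, one_mul]
    | zero => rw [mul_zero]; exact Submodule.zero_mem _
    | add a b _ _ ha hb => rw [mul_add]; exact Submodule.add_mem _ ha hb
    | smul c a _ ha => rw [mul_smul_comm]; exact Submodule.smul_mem _ _ ha
  | mul a b ha hb =>
    intro s hs
    rw [map_mul, mul_assoc]
    exact ha _ (hb _ hs)
  | add a b ha hb =>
    intro s hs
    rw [map_add, add_mul]
    exact Submodule.add_mem _ (ha _ hs) (hb _ hs)

/-- the monomials `x^i y^j` (`i, j ≥ 0`) form a `k`-basis of `R`: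
they are linearly independent over `k` and span `R` as a `k`-vector space. -/
theorem monomials_form_basis (k : Type) [Field k] :
    LinearIndependent k (fun p : ℕ × ℕ => Xg k ^ p.1 * Yg k ^ p.2) ∧
    Submodule.span k (Set.range fun p : ℕ × ℕ => Xg k ^ p.1 * Yg k ^ p.2) = ⊤ := by
  constructor
  · apply LinearIndependent.of_comp
      ((LinearMap.applyₗ (Finsupp.single ((0, 0) : ℕ × ℕ) (1 : k))).comp (rep k).toLinearMap)
    convert Finsupp.linearIndependent_single_one k (ℕ × ℕ) using 1
    funext ⟨i, j⟩
    change rep k (Xg k ^ i * Yg k ^ j) (Finsupp.single (0, 0) 1) = _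
    rw [map_mul, Module.End.mul_apply, rep_Y_pow, rep_X_pow]
    rfl
  · rw [eq_top_iff]
    rintro r -
    obtain ⟨a, rfl⟩ := RingQuot.mkAlgHom_surjective k (PreRel k) r
    rw [← mul_one (RingQuot.mkAlgHom k (PreRel k) a)]
    exact mul_mem_span_monomials k a 1 (Submodule.subset_span ⟨(0, 0), by simp⟩)
end
end

section
/- The proper two-sided ideals of R are exactly the following: the zero ideal, the ideal F = ⟨1 − xy⟩, and the ideals ⟨1 − xy, f(x)⟩ generated by 1 − xy together with f(x), where f ranges over the monic polynomials in k[X] that are not monomials (i.e., f ≠ X^n for every n ≥ 0), and f(x) denotes the image of f under the k-algebra map k[X] → R sending X to x. -/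
/-!
`R = k⟨x,y⟩/⟨yx − 1⟩` is the associative `k`-algebra generated by `x` and `y`
with the single defining relation `y * x = 1` (the one-sided inverse of `k[x]`).
We realize it as the `RingQuot` of the free algebra on two generators.
-/

noncomputable section

/-- `F = ⟨1 − xy⟩`, the two-sided ideal of `R` generated by `1 − xy`. -/
def Fideal (k : Type) [Field k] : TwoSidedIdeal (R k) :=
  TwoSidedIdeal.span {1 - Xg k * Yg k}

namespace OneSided

open Polynomial

section generic

variable {k A : Type} [Field k] [Ring A] [Algebra k A] {x y : A}

theorem e_mul_aeval (h : y * x = 1) (p : k[X]) :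
    (1 - x * y) * aeval x p = p.coeff 0 • (1 - x * y) := by
  have hx : (1 - x * y) * x = 0 := by
    rw [sub_mul, mul_assoc, h, one_mul, mul_one, sub_self]
  conv_lhs => rw [← divX_mul_X_add p]
  rw [mul_comm, map_add, map_mul, aeval_X, aeval_C, mul_add, ← mul_assoc, hx, zero_mul, zero_add,
    Algebra.smul_def, Algebra.commutes]

theorem y_mul_aeval (h : y * x = 1) (p : k[X]) :
    y * aeval x p = aeval x p.divX + p.coeff 0 • y := by
  conv_lhs => rw [← divX_mul_X_add p]
  rw [mul_comm, map_add, map_mul, aeval_X, aeval_C, mul_add, ← mul_assoc, h, one_mul,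
    Algebra.smul_def, Algebra.commutes]

theorem y_mul_e (h : y * x = 1) : y * (1 - x * y) = 0 := by
  rw [mul_sub, ← mul_assoc, h, one_mul, mul_one, sub_self]

theorem pow_mul_pow (h : y * x = 1) (n : ℕ) : y ^ n * x ^ n = 1 := by
  induction n with
  | zero => simp
  | succ n ih =>
    rw [pow_succ, pow_succ', mul_assoc, ← mul_assoc y x, h, one_mul, ih]

theorem smul_mem_inv (I : TwoSidedIdeal A) {c : k} (hc : c ≠ 0) {a : A} (h : c • a ∈ I) :
    a ∈ I := by
  have := I.mul_mem_left (algebraMap k A c⁻¹) _ h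
  rwa [← Algebra.smul_def, smul_smul, inv_mul_cancel₀ hc, one_smul] at this

theorem e_mem_of_aeval (h : y * x = 1) (I : TwoSidedIdeal A) (n : ℕ) :
    ∀ p : k[X], p.natDegree ≤ n → p ≠ 0 → aeval x p ∈ I → 1 - x * y ∈ I := by
  induction n with
  | zero =>
    intro p hp h0 hI
    have hc : p.coeff 0 ≠ 0 := by
      intro hc
      rw [eq_C_of_natDegree_le_zero hp, hc, C_0] at h0
      exact h0 rfl
    apply smul_mem_inv I hc
    rw [← e_mul_aeval h]
    exact I.mul_mem_left _ _ hI
  | succ n ih =>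
    intro p hp h0 hI
    by_cases hc : p.coeff 0 = 0
    · apply ih p.divX
      · rw [natDegree_divX_eq_natDegree_tsub_one]; omega
      · intro hd
        rw [divX_eq_zero_iff, hc, C_0] at hd
        exact h0 hd
      · have := I.mul_mem_left y _ hI
        rwa [y_mul_aeval h, hc, zero_smul, add_zero] at this
    · apply smul_mem_inv I hc
      rw [← e_mul_aeval h]
      exact I.mul_mem_left _ _ hI

theorem e_mem_of_aeval_mul_e (h : y * x = 1) (I : TwoSidedIdeal A) (n : ℕ) :
    ∀ p : k[X], p.natDegree ≤ n → p ≠ 0 → aeval x p * (1 - x * y) ∈ I → 1 - x * y ∈ I := by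
  induction n with
  | zero =>
    intro p hp h0 hI
    have hc : p.coeff 0 ≠ 0 := by
      intro hc
      rw [eq_C_of_natDegree_le_zero hp, hc, C_0] at h0
      exact h0 rfl
    apply smul_mem_inv I hc
    rw [eq_C_of_natDegree_le_zero hp, aeval_C, ← Algebra.smul_def] at hI
    exact hI
  | succ n ih =>
    intro p hp h0 hI
    by_cases hd : p.divX = 0
    · rw [divX_eq_zero_iff] at hd
      have hc : p.coeff 0 ≠ 0 := by
        intro hc
        rw [hc, C_0] at hd
        exact h0 hd
      apply smul_mem_inv I hc
      rw [hd, aeval_C, ← Algebra.smul_def] at hI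
      exact hI
    · apply ih p.divX _ hd
      · have := I.mul_mem_left y _ hI
        rwa [← mul_assoc, y_mul_aeval h, add_mul, smul_mul_assoc, y_mul_e h, smul_zero,
          add_zero] at this
      · rw [natDegree_divX_eq_natDegree_tsub_one]; omega

theorem one_sub_mem (I : TwoSidedIdeal A) (he : 1 - x * y ∈ I) (n : ℕ) :
    1 - x ^ n * y ^ n ∈ I := by
  induction n with
  | zero => simp
  | succ n ih =>
    have h1 := I.mul_mem_right _ (y ^ n) (I.mul_mem_left (x ^ n) _ he)
    have h2 := I.add_mem ih h1
    have e : 1 - x ^ (n + 1) * y ^ (n + 1) =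
        1 - x ^ n * y ^ n + x ^ n * (1 - x * y) * y ^ n := by
      rw [pow_succ x, pow_succ' y]
      noncomm_ring
    rwa [e]

end generic

variable (k : Type) [Field k]

theorem yx : Yg k * Xg k = 1 := by
  rw [Yg, Xg, ← map_mul, RingQuot.mkAlgHom_rel k PreRel.yx, map_one]

theorem R_induction {motive : R k → Prop} (hc : ∀ c : k, motive (algebraMap k (R k) c))
    (hx : motive (Xg k)) (hy : motive (Yg k))
    (mul : ∀ a b, motive a → motive b → motive (a * b))
    (add : ∀ a b, motive a → motive b → motive (a + b)) (a : R k) : motive a := by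
  obtain ⟨b, rfl⟩ := RingQuot.mkAlgHom_surjective k (PreRel k) a
  induction b using FreeAlgebra.induction with
  | grade0 r => rw [AlgHom.commutes]; exact hc r
  | grade1 i =>
    fin_cases i
    · exact hx
    · exact hy
  | mul a b ha hb => rw [map_mul]; exact mul _ _ ha hb
  | add a b ha hb => rw [map_add]; exact add _ _ ha hb

theorem exists_pow (a : R k) : ∃ (n : ℕ) (p : k[X]), a * Xg k ^ n = aeval (Xg k) p := by
  induction a using R_induction with
  | hc c => exact ⟨0, C c, by simp⟩
  | hx => exact ⟨0, X, by simp⟩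
  | hy => exact ⟨1, 1, by simp [yx]⟩
  | mul a b ha hb =>
    obtain ⟨m, q, hq⟩ := ha
    obtain ⟨n, p, hp⟩ := hb
    refine ⟨n + m, q * p, ?_⟩
    have hcomm : aeval (Xg k) p * Xg k ^ m = Xg k ^ m * aeval (Xg k) p := by
      have : Xg k ^ m = aeval (Xg k) (X ^ m : k[X]) := by simp
      rw [this, ← map_mul, ← map_mul, mul_comm]
    rw [pow_add, mul_assoc, ← mul_assoc b, hp, hcomm, ← mul_assoc, hq, map_mul]
  | add a b ha hb =>
    obtain ⟨m, q, hq⟩ := ha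
    obtain ⟨n, p, hp⟩ := hb
    refine ⟨n + m, q * X ^ n + p * X ^ m, ?_⟩
    rw [add_mul, map_add, map_mul, map_mul, map_pow, map_pow, aeval_X, ← hq, ← hp, mul_assoc,
      mul_assoc, ← pow_add, ← pow_add, add_comm m n]

theorem exists_mul_e (a : R k) : ∀ p : k[X], ∃ q : k[X],
    a * (aeval (Xg k) p * (1 - Xg k * Yg k)) = aeval (Xg k) q * (1 - Xg k * Yg k) := by
  induction a using R_induction with
  | hc c => exact fun p => ⟨C c * p, by rw [map_mul, aeval_C, mul_assoc]⟩
  | hx => exact fun p => ⟨X * p, by rw [map_mul, aeval_X, mul_assoc]⟩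
  | hy =>
    exact fun p => ⟨p.divX, by
      rw [← mul_assoc, y_mul_aeval (yx k), add_mul, smul_mul_assoc, y_mul_e (yx k), smul_zero,
        add_zero]⟩
  | mul a b ha hb =>
    intro p
    obtain ⟨q, hq⟩ := hb p
    obtain ⟨r, hr⟩ := ha q
    exact ⟨r, by rw [mul_assoc, hq, hr]⟩
  | add a b ha hb =>
    intro p
    obtain ⟨q, hq⟩ := hb p
    obtain ⟨r, hr⟩ := ha p
    exact ⟨r + q, by rw [add_mul, hq, hr, map_add, add_mul]⟩

theorem e_mem_of_mul_X (I : TwoSidedIdeal (R k)) (n : ℕ) : ∀ a : R k, a ∈ I → a ≠ 0 →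
    a * Xg k ^ n = 0 → 1 - Xg k * Yg k ∈ I := by
  induction n with
  | zero => intro a _ h0 h; simp at h; exact absurd h h0
  | succ n ih =>
    intro a ha h0 h
    by_cases hb : a * Xg k = 0
    · have hae : a * (aeval (Xg k) (1 : k[X]) * (1 - Xg k * Yg k)) = a := by
        rw [map_one, one_mul, mul_sub, ← mul_assoc, hb, zero_mul, mul_one, sub_zero]
      obtain ⟨q, hq⟩ := exists_mul_e k a 1
      rw [hae] at hq
      refine e_mem_of_aeval_mul_e (yx k) I q.natDegree q le_rfl ?_ (hq ▸ ha)
      rintro rfl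
      rw [map_zero, zero_mul] at hq
      exact h0 hq
    · exact ih _ (I.mul_mem_right _ _ ha) hb (by rw [mul_assoc, ← pow_succ', h])

theorem e_mem (I : TwoSidedIdeal (R k)) (hI : I ≠ ⊥) : 1 - Xg k * Yg k ∈ I := by
  obtain ⟨a, ha, h0⟩ : ∃ a ∈ I, a ≠ 0 := by
    by_contra! hcon
    apply hI
    apply le_bot_iff.mp
    intro a ha
    exact (TwoSidedIdeal.mem_bot _).mpr (hcon a ha)
  obtain ⟨n, p, hp⟩ := exists_pow k a
  by_cases hp0 : p = 0
  · rw [hp0, map_zero] at hp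
    exact e_mem_of_mul_X k I n a ha h0 hp
  · exact e_mem_of_aeval (yx k) I p.natDegree p le_rfl hp0 (hp ▸ I.mul_mem_right _ _ ha)

theorem mem_iff (I : TwoSidedIdeal (R k)) (he : 1 - Xg k * Yg k ∈ I) (a : R k) (n : ℕ)
    (h : a * Xg k ^ n ∈ I) : a ∈ I := by
  have h1 := I.add_mem (I.mul_mem_right _ (Yg k ^ n) h)
    (I.mul_mem_left a _ (one_sub_mem I he n))
  have e : a * Xg k ^ n * Yg k ^ n + a * (1 - Xg k ^ n * Yg k ^ n) = a := by
    rw [mul_sub, mul_one, mul_assoc, add_sub_cancel]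
  rwa [e] at h1

theorem span_ne_top (f : k[X]) (hf : f.Monic) (hn : ∀ n : ℕ, f ≠ X ^ n) :
    TwoSidedIdeal.span {1 - Xg k * Yg k, aeval (Xg k) f} ≠ ⊤ := by
  let K := AlgebraicClosure k
  obtain ⟨u, hu, hu0⟩ : ∃ u : K, aeval u f = 0 ∧ u ≠ 0 := by
    by_contra! hcon
    have hs := (IsAlgClosed.splits (f.map (algebraMap k K))).eq_prod_roots_of_monic (hf.map _)
    have hr : (f.map (algebraMap k K)).roots =
        Multiset.replicate (Multiset.card (f.map (algebraMap k K)).roots) 0 := by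
      rw [Multiset.eq_replicate]
      refine ⟨rfl, fun b hb => hcon b ?_⟩
      have := isRoot_of_mem_roots hb
      rwa [IsRoot, eval_map_algebraMap] at this
    rw [hr] at hs
    apply hn (Multiset.card (f.map (algebraMap k K)).roots)
    apply map_injective (algebraMap k K) (algebraMap k K).injective
    rw [hs]
    simp
  let g : FreeAlgebra k (Fin 2) →ₐ[k] K := FreeAlgebra.lift k ![u, u⁻¹]
  have w : ∀ ⦃a b⦄, PreRel k a b → g a = g b := by
    rintro _ _ ⟨⟩
    simp [g, hu0]
  let φ : R k →ₐ[k] K := RingQuot.liftAlgHom k ⟨g, w⟩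
  have hx : φ (Xg k) = u := by
    simp [φ, Xg, g]
  have hy : φ (Yg k) = u⁻¹ := by
    simp [φ, Yg, g]
  intro htop
  have hle : TwoSidedIdeal.span {1 - Xg k * Yg k, aeval (Xg k) f} ≤ TwoSidedIdeal.ker φ := by
    rw [TwoSidedIdeal.span_le]
    rintro a (rfl | rfl)
    · change _ ∈ TwoSidedIdeal.ker φ
      rw [TwoSidedIdeal.mem_ker, map_sub, map_mul, map_one, hx, hy, mul_inv_cancel₀ hu0, sub_self]
    · change _ ∈ TwoSidedIdeal.ker φ
      rw [TwoSidedIdeal.mem_ker, ← aeval_algHom_apply, hx, hu]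
  have h1 : (1 : R k) ∈ TwoSidedIdeal.ker φ := hle ((TwoSidedIdeal.one_mem_iff _).mpr htop)
  rw [TwoSidedIdeal.mem_ker, map_one] at h1
  exact one_ne_zero h1

theorem Fideal_ne_top : Fideal k ≠ ⊤ := by
  intro htop
  apply span_ne_top k (X - C 1) (monic_X_sub_C 1)
  · intro n h
    have h1 := congrArg (eval 1) h
    simp at h1
  · rw [eq_top_iff, ← htop, Fideal, TwoSidedIdeal.span_le]
    intro a ha
    exact TwoSidedIdeal.subset_span (Or.inl ha)

theorem classify (I : TwoSidedIdeal (R k)) (hI : I ≠ ⊤) (hb : I ≠ ⊥) : I = Fideal k ∨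
        ∃ f : k[X], f.Monic ∧ (∀ n : ℕ, f ≠ X ^ n) ∧
          I = TwoSidedIdeal.span {1 - Xg k * Yg k, aeval (Xg k) f} := by
  classical
  have he := e_mem k I hb
  let J : Ideal k[X] :=
    { carrier := {p | aeval (Xg k) p ∈ I}
      add_mem' := by
        intro a b ha hb
        simp only [Set.mem_ofPred_eq, map_add] at *
        exact I.add_mem ha hb
      zero_mem' := by
        simp only [Set.mem_ofPred_eq, map_zero]
        exact I.zero_mem
      smul_mem' := by
        intro c a ha
        simp only [Set.mem_ofPred_eq, smul_eq_mul, map_mul] at *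
        exact I.mul_mem_left _ _ ha }
  have hJ : ∀ p, p ∈ J ↔ aeval (Xg k) p ∈ I := fun p => Iff.rfl
  by_cases hJ0 : J = ⊥
  · left
    apply le_antisymm
    · intro a ha
      obtain ⟨n, p, hp⟩ := exists_pow k a
      have hpI : p ∈ J := by
        rw [hJ, ← hp]; exact I.mul_mem_right _ _ ha
      rw [hJ0, Ideal.mem_bot] at hpI
      apply mem_iff k (Fideal k) (TwoSidedIdeal.subset_span (Set.mem_singleton _)) a n
      rw [hp, hpI, map_zero]
      exact TwoSidedIdeal.zero_mem _
    · rw [Fideal, TwoSidedIdeal.span_le]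
      rintro a rfl
      exact he
  · right
    obtain ⟨g, hg⟩ := (IsPrincipalIdealRing.principal J).principal
    have hg0 : g ≠ 0 := by
      rintro rfl
      apply hJ0
      rw [hg]; simp
    have hmem : ∀ p, p ∈ J ↔ normalize g ∣ p := by
      intro p
      rw [normalize_dvd_iff, hg]
      exact Ideal.mem_span_singleton
    have hfI : aeval (Xg k) (normalize g) ∈ I := (hJ _).mp ((hmem _).mpr dvd_rfl)
    refine ⟨normalize g, monic_normalize hg0, ?_, ?_⟩
    · intro n hn
      apply hI
      rw [hn, map_pow, aeval_X] at hfI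
      rw [← TwoSidedIdeal.one_mem_iff, ← pow_mul_pow (yx k) n]
      exact I.mul_mem_left _ _ hfI
    · apply le_antisymm
      · intro a ha
        obtain ⟨n, p, hp⟩ := exists_pow k a
        have hpI : p ∈ J := by
          rw [hJ, ← hp]; exact I.mul_mem_right _ _ ha
        obtain ⟨q, rfl⟩ := (hmem p).mp hpI
        apply mem_iff k _ (TwoSidedIdeal.subset_span (Or.inl rfl)) a n
        rw [hp, map_mul]
        exact TwoSidedIdeal.mul_mem_right _ _ _ (TwoSidedIdeal.subset_span (Or.inr rfl))
      · rw [TwoSidedIdeal.span_le]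
        rintro a (rfl | rfl)
        · exact he
        · exact hfI

end OneSided

open Polynomial in
/-- the proper two-sided ideals of `R` are exactly `0`, `F = ⟨1 − xy⟩`, and
`⟨1 − xy, f(x)⟩` where `f` ranges over monic polynomials in `k[X]` that are not
monomials (`f ≠ X^n` for all `n ≥ 0`), and `f(x)` is the image of `f` under
`k[X] → R`, `X ↦ x`. -/
theorem proper_ideal_classification (k : Type) [Field k] (I : TwoSidedIdeal (R k)) :
    I ≠ ⊤ ↔
      (I = ⊥ ∨ I = Fideal k ∨
        ∃ f : k[X], f.Monic ∧ (∀ n : ℕ, f ≠ X ^ n) ∧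
          I = TwoSidedIdeal.span {1 - Xg k * Yg k, aeval (Xg k) f}) := by
  constructor
  · intro hI
    by_cases hb : I = ⊥
    · exact Or.inl hb
    · exact Or.inr (OneSided.classify k I hI hb)
  · rintro (rfl | rfl | ⟨f, hf, hn, rfl⟩)
    · intro h
      apply OneSided.Fideal_ne_top k
      rw [eq_top_iff, ← h]
      exact bot_le
    · exact OneSided.Fideal_ne_top k
    · exact OneSided.span_ne_top k f hf hn
end
end

section
/- The prime two-sided ideals of R are exactly: the zero ideal, the ideal F = ⟨1 − xy⟩, and the maximal ideals ⟨1 − xy, f(x)⟩ with f a monic irreducible polynomial in k[X] that is not a monomial. Here a proper two-sided ideal P of R is called prime if for all two-sided ideals I, J of R, IJ ⊆ P implies I ⊆ P or J ⊆ P. -/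
/-!
`R = k⟨x,y⟩/⟨yx − 1⟩` is the associative `k`-algebra generated by `x` and `y`
with the single defining relation `y * x = 1` (the one-sided inverse of `k[x]`).
We realize it as the `RingQuot` of the free algebra on two generators.
-/

noncomputable section

section helpers
open Polynomial

variable {k : Type} [Field k]

lemma yx_one : Yg k * Xg k = 1 := by
  unfold Yg Xg
  rw [← map_mul, RingQuot.mkAlgHom_rel k PreRel.yx, map_one]

/-- Universal property of `R`. -/
lemma exists_hom {B : Type*} [Ring B] [Algebra k B] (u v : B) (h : v * u = 1) :
    ∃ φ : R k →ₐ[k] B, φ (Xg k) = u ∧ φ (Yg k) = v := by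
  have w : ∀ ⦃a b⦄, PreRel k a b →
      FreeAlgebra.lift k (![u, v]) a = FreeAlgebra.lift k (![u, v]) b := by
    rintro _ _ ⟨⟩
    simp [h]
  refine ⟨RingQuot.liftAlgHom k ⟨FreeAlgebra.lift k (![u, v]), w⟩, ?_, ?_⟩
  · unfold Xg
    rw [RingQuot.liftAlgHom_mkAlgHom_apply]
    simp
  · unfold Yg
    rw [RingQuot.liftAlgHom_mkAlgHom_apply]
    simp

/-- Elements of the form `∑ pⱼ(x) yʲ`. -/
inductive Good : R k → Prop
  | zero : Good 0
  | step (p : k[X]) (b : R k) : Good b → Good (aeval (Xg k) p + b * Yg k)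

lemma Good.add {a b : R k} (ha : Good a) (hb : Good b) : Good (a + b) := by
  induction ha generalizing b with
  | zero => simpa using hb
  | step p a ha ih =>
    cases hb with
    | zero => simpa using Good.step p a ha
    | step q b hb =>
      have := Good.step (p + q) _ (ih hb)
      convert this using 1
      rw [map_add]; noncomm_ring

lemma Good.poly (p : k[X]) : Good (aeval (Xg k) p) := by
  simpa using Good.step p 0 Good.zero

lemma Good.poly_mul (q : k[X]) {a : R k} (ha : Good a) : Good (aeval (Xg k) q * a) := by
  induction ha with
  | zero => simpa using Good.zero
  | step p a ha ih =>
    have := Good.step (q * p) _ ih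
    convert this using 1
    rw [map_mul]; noncomm_ring

lemma y_poly (p : k[X]) :
    Yg k * aeval (Xg k) p = aeval (Xg k) p.divX + aeval (Xg k) (C (p.coeff 0)) * Yg k := by
  conv_lhs => rw [← divX_mul_X_add p, mul_comm]
  rw [map_add, map_mul, aeval_X, mul_add, ← mul_assoc, yx_one, one_mul, aeval_C,
    Algebra.commutes]

lemma Good.y_mul {a : R k} (ha : Good a) : Good (Yg k * a) := by
  induction ha with
  | zero => simpa using Good.zero
  | step p a ha ih =>
    have := Good.step p.divX _ ((Good.poly (C (p.coeff 0))).add ih)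
    convert this using 1
    rw [mul_add, y_poly]; noncomm_ring

lemma good_all (a : R k) : Good a := by
  suffices h : ∀ r : R k, ∀ b : R k, Good b → Good (r * b) by
    have h1 : Good (1 : R k) := by simpa using Good.poly (k := k) 1
    simpa using h a 1 h1
  intro r
  obtain ⟨r, rfl⟩ := RingQuot.mkAlgHom_surjective k (PreRel k) r
  induction r using FreeAlgebra.induction with
  | grade0 c =>
    intro b hb
    simpa using hb.poly_mul (C c)
  | grade1 i =>
    intro b hb
    fin_cases i
    · have := hb.poly_mul X
      rw [aeval_X] at this
      exact this
    · exact hb.y_mul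
  | mul r s hr hs =>
    intro b hb
    rw [map_mul, mul_assoc]
    exact hr _ (hs _ hb)
  | add r s hr hs =>
    intro b hb
    rw [map_add, add_mul]
    exact (hr _ hb).add (hs _ hb)

lemma exists_mul_pow (a : R k) : ∃ (n : ℕ) (p : k[X]), a * Xg k ^ n = aeval (Xg k) p := by
  induction good_all a with
  | zero => exact ⟨0, 0, by simp⟩
  | step p b hb ih =>
    obtain ⟨n, q, h⟩ := ih
    refine ⟨n + 1, p * X ^ (n + 1) + q, ?_⟩
    rw [add_mul, pow_succ', mul_assoc b, ← mul_assoc (Yg k), yx_one, one_mul, h]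
    simp [pow_succ']

lemma mem_of_mul_pow (N : TwoSidedIdeal (R k)) (he : 1 - Xg k * Yg k ∈ N) (a : R k) (n : ℕ)
    (h : a * Xg k ^ n ∈ N) : a ∈ N := by
  induction n with
  | zero => simpa using h
  | succ n ih =>
    apply ih
    rw [pow_succ, ← mul_assoc] at h
    have h1 := N.mul_mem_right _ (Yg k) h
    have h2 := N.mul_mem_left (a * Xg k ^ n) _ he
    have h3 := N.add_mem h1 h2
    rwa [mul_sub, mul_one, ← mul_assoc, add_sub_cancel] at h3

lemma e_x : (1 - Xg k * Yg k) * Xg k = 0 := by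
  rw [sub_mul, mul_assoc, yx_one]; simp

lemma y_e : Yg k * (1 - Xg k * Yg k) = 0 := by
  rw [mul_sub, ← mul_assoc, yx_one]; simp

lemma e_e : (1 - Xg k * Yg k) * (1 - Xg k * Yg k) = 1 - Xg k * Yg k := by
  rw [sub_mul, mul_assoc, y_e]; simp

lemma e_mem_of_poly (I : TwoSidedIdeal (R k)) (p : k[X]) (hp : p ≠ 0)
    (h : aeval (Xg k) p * (1 - Xg k * Yg k) ∈ I) : 1 - Xg k * Yg k ∈ I := by
  induction p using Polynomial.recOnHorner with
  | M0 => exact absurd rfl hp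
  | MC p a h0 ha _ =>
    have h1 := I.mul_mem_left (1 - Xg k * Yg k) _ h
    have h2 : (1 - Xg k * Yg k) * aeval (Xg k) p = 0 := by
      obtain ⟨q, rfl⟩ := X_dvd_iff.mpr h0
      rw [map_mul, aeval_X, ← mul_assoc, e_x, zero_mul]
    rw [map_add, add_mul, mul_add, ← mul_assoc, h2, zero_mul, zero_add, aeval_C,
      Algebra.commutes, ← mul_assoc, e_e] at h1
    have h3 := I.mul_mem_right _ (algebraMap k (R k) a⁻¹) h1
    rwa [mul_assoc, ← map_mul, mul_inv_cancel₀ ha, map_one, mul_one] at h3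
  | MX p hp0 ih =>
    apply ih hp0
    have h1 := I.mul_mem_left (Yg k) _ h
    rwa [mul_comm p X, map_mul, aeval_X, ← mul_assoc, ← mul_assoc, yx_one, one_mul] at h1

lemma e_mem (I : TwoSidedIdeal (R k)) (a : R k) (ha : a ≠ 0) (h : a ∈ I) :
    1 - Xg k * Yg k ∈ I := by
  induction good_all a with
  | zero => exact absurd rfl ha
  | step p b hb ih =>
    by_cases hp : p = 0
    · subst hp
      rw [map_zero, zero_add] at h ha
      apply ih
      · rintro rfl
        simp at ha
      · have h1 := I.mul_mem_right _ (Xg k) h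
        rwa [mul_assoc, yx_one, mul_one] at h1
    · apply e_mem_of_poly I p hp
      have h1 := I.mul_mem_right _ (1 - Xg k * Yg k) h
      rwa [add_mul, mul_assoc b, y_e, mul_zero, add_zero] at h1

lemma e_ne_zero : 1 - Xg k * Yg k ≠ 0 := by
  let u : Module.End k k[X] := LinearMap.mulLeft k X
  let v : Module.End k k[X] :=
    { toFun := divX
      map_add' := fun _ _ => divX_add
      map_smul' := fun c p => by ext; simp [coeff_divX] }
  obtain ⟨φ, h1, h2⟩ := exists_hom (k := k) u v (by
    ext n m; simp [u, v, coeff_divX, coeff_monomial])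
  intro h
  have h3 := congrArg (fun r => φ r (1 : k[X])) h
  simp [h1, h2, u, v] at h3

lemma prime_of_hom {K : Type*} [Field K] [Algebra k K] (u : K) (hu : u ≠ 0)
    (N : TwoSidedIdeal (R k)) (he : 1 - Xg k * Yg k ∈ N)
    (h1 : ∀ p : k[X], aeval u p = 0 → aeval (Xg k) p ∈ N)
    (h2 : ∀ φ : R k →ₐ[k] K, φ (Xg k) = u → φ (1 - Xg k * Yg k) = 0 → ∀ a ∈ N, φ a = 0) :
    N ≠ ⊤ ∧ ∀ I J : TwoSidedIdeal (R k),
        (∀ a ∈ I, ∀ b ∈ J, a * b ∈ N) → I ≤ N ∨ J ≤ N := by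
  obtain ⟨φ, hx, hy⟩ := exists_hom (k := k) u u⁻¹ (inv_mul_cancel₀ hu)
  have h2 := h2 φ hx (by simp [hx, hy, hu])
  have h3 : ∀ a, φ a = 0 → a ∈ N := by
    intro a ha
    obtain ⟨n, p, h⟩ := exists_mul_pow a
    apply mem_of_mul_pow N he a n
    rw [h]
    apply h1
    have := congrArg φ h
    rw [map_mul, ha, zero_mul, ← aeval_algHom_apply, hx] at this
    exact this.symm
  constructor
  · rintro rfl
    have := h2 1 (TwoSidedIdeal.mem_top _)
    simp at this
  · intro I J h
    by_contra! hc
    obtain ⟨a, ha, ha'⟩ := SetLike.not_le_iff_exists.mp hc.1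
    obtain ⟨b, hb, hb'⟩ := SetLike.not_le_iff_exists.mp hc.2
    have := h2 _ (h a ha b hb)
    rw [map_mul, mul_eq_zero] at this
    exact this.elim (fun h => ha' (h3 a h)) (fun h => hb' (h3 b h))

lemma span_le_ker {B : Type*} [Ring B] (φ : R k →+* B) (s : Set (R k))
    (h : ∀ a ∈ s, φ a = 0) : ∀ a ∈ TwoSidedIdeal.span s, φ a = 0 := by
  have : TwoSidedIdeal.span s ≤ TwoSidedIdeal.comap φ ⊥ := by
    rw [TwoSidedIdeal.span_le]
    intro a ha
    simpa [TwoSidedIdeal.mem_comap, TwoSidedIdeal.mem_bot] using h a ha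
  intro a ha
  simpa [TwoSidedIdeal.mem_comap, TwoSidedIdeal.mem_bot] using this ha

lemma elem_prime {S : Type*} [Ring S] (P : TwoSidedIdeal (S))
    (hP : ∀ I J : TwoSidedIdeal (S),
        (∀ a ∈ I, ∀ b ∈ J, a * b ∈ P) → I ≤ P ∨ J ≤ P)
    (a b : S) (h : ∀ r, a * r * b ∈ P) : a ∈ P ∨ b ∈ P := by
  let J : TwoSidedIdeal (S) := TwoSidedIdeal.mk' {c | ∀ r, a * r * c ∈ P}
    (by intro r; simp)
    (by intro c d hc hd r; rw [mul_add]; exact P.add_mem (hc r) (hd r))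
    (by intro c hc r; rw [mul_neg]; exact P.neg_mem (hc r))
    (by intro c d hd r; have := hd (r * c); simpa only [mul_assoc] using this)
    (by intro c d hc r; have := P.mul_mem_right _ d (hc r); simpa only [mul_assoc] using this)
  have hJ : ∀ c, c ∈ J ↔ ∀ r, a * r * c ∈ P := fun c => TwoSidedIdeal.mem_mk' _ _ _ _ _ _ _
  let I : TwoSidedIdeal (S) := TwoSidedIdeal.mk' {d | ∀ c ∈ J, ∀ r, d * r * c ∈ P}
    (by intro c _ r; simp)
    (by intro c d hc hd j hj r; rw [add_mul, add_mul]; exact P.add_mem (hc j hj r) (hd j hj r))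
    (by intro c hc j hj r; rw [neg_mul, neg_mul]; exact P.neg_mem (hc j hj r))
    (by intro c d hd j hj r; have := P.mul_mem_left c _ (hd j hj r)
        simpa only [mul_assoc] using this)
    (by intro c d hc j hj r; have := hc j hj (d * r); simpa only [mul_assoc] using this)
  have hI : ∀ d, d ∈ I ↔ ∀ c ∈ J, ∀ r, d * r * c ∈ P :=
    fun c => TwoSidedIdeal.mem_mk' _ _ _ _ _ _ _
  rcases hP I J (fun d hd c hc => by simpa using (hI d).1 hd c hc 1) with h1 | h1
  · exact Or.inl (h1 ((hI a).2 fun c hc => (hJ c).1 hc))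
  · exact Or.inr (h1 ((hJ b).2 h))

lemma classify (P : TwoSidedIdeal (R k)) (hT : P ≠ ⊤)
    (hP : ∀ I J : TwoSidedIdeal (R k),
        (∀ a ∈ I, ∀ b ∈ J, a * b ∈ P) → I ≤ P ∨ J ≤ P)
    (he : 1 - Xg k * Yg k ∈ P) :
    P = Fideal k ∨
        ∃ f : k[X], f.Monic ∧ Irreducible f ∧ (∀ n : ℕ, f ≠ X ^ n) ∧
          P = TwoSidedIdeal.span {1 - Xg k * Yg k, aeval (Xg k) f} := by
  have h1 : (1 : R k) ∉ P := fun h => hT (TwoSidedIdeal.one_mem_iff P |>.1 h)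
  let Q : Ideal k[X] := P.asIdeal.comap (aeval (Xg k))
  have hQ : ∀ p, p ∈ Q ↔ aeval (Xg k) p ∈ P := fun p => by
    simp [Q, Ideal.mem_comap, TwoSidedIdeal.mem_asIdeal]
  have hprime : Q.IsPrime := by
    refine Ideal.isPrime_iff.2 ⟨?_, ?_⟩
    · rw [Ideal.ne_top_iff_one, hQ, map_one]
      exact h1
    · intro p q hpq
      rw [hQ] at hpq
      rw [hQ, hQ]
      apply elem_prime P hP
      intro r
      obtain ⟨n, s, hs⟩ := exists_mul_pow r
      apply mem_of_mul_pow P he _ n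
      have : aeval (Xg k) p * r * aeval (Xg k) q * Xg k ^ n
          = aeval (Xg k) s * aeval (Xg k) (p * q) := by
        have h2 : aeval (Xg k) q * Xg k ^ n = Xg k ^ n * aeval (Xg k) q := by
          have h3 : Xg k ^ n = aeval (Xg k) (X ^ n : k[X]) := by simp
          rw [h3, ← map_mul, mul_comm, map_mul]
        rw [mul_assoc, h2, mul_assoc, ← mul_assoc r, hs, ← map_mul, ← map_mul, ← map_mul]
        congr 1; ring
      rw [this]
      exact P.mul_mem_left _ _ hpq
  by_cases hbot : Q = ⊥
  · left
    apply le_antisymm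
    · intro a ha
      have heF : 1 - Xg k * Yg k ∈ Fideal k := TwoSidedIdeal.subset_span rfl
      obtain ⟨n, p, h⟩ := exists_mul_pow a
      apply mem_of_mul_pow _ heF a n
      have hp : p ∈ Q := (hQ p).2 (h ▸ P.mul_mem_right _ _ ha)
      rw [hbot, Ideal.mem_bot] at hp
      rw [h, hp, map_zero]
      exact TwoSidedIdeal.zero_mem _
    · unfold Fideal
      rw [TwoSidedIdeal.span_le]
      simpa using he
  · right
    classical
    obtain ⟨g, hg⟩ := (IsPrincipalIdealRing.principal Q).principal
    have hg : Q = Ideal.span {g} := hg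
    have hg0 : g ≠ 0 := by
      rintro rfl
      exact hbot (by simpa using hg)
    have hgf : Q = Ideal.span {normalize g} := by
      rw [hg, Ideal.span_singleton_eq_span_singleton]
      exact (normalize_associated g).symm
    have hf0 : normalize g ≠ 0 := by simpa using hg0
    have hm : (normalize g).Monic := monic_normalize hg0
    generalize normalize g = f at hgf hf0 hm
    have hfQ : aeval (Xg k) f ∈ P := (hQ f).1 (by rw [hgf]; exact Ideal.mem_span_singleton_self f)
    refine ⟨f, hm, ?_, ?_, ?_⟩
    · rw [hgf] at hprime
      exact ((Ideal.span_singleton_prime hf0).1 hprime).irreducible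
    · rintro n rfl
      apply h1
      have : ∀ m : ℕ, Xg k ^ m ∈ P → (1 : R k) ∈ P := by
        intro m
        induction m with
        | zero => intro h; simpa using h
        | succ m ih =>
          intro h
          apply ih
          have := P.mul_mem_left (Yg k) _ h
          rwa [pow_succ', ← mul_assoc, yx_one, one_mul] at this
      exact this n (by simpa using hfQ)
    · apply le_antisymm
      · intro a ha
        have heS : 1 - Xg k * Yg k ∈
            TwoSidedIdeal.span {1 - Xg k * Yg k, aeval (Xg k) f} :=
          TwoSidedIdeal.subset_span (by simp)
        have hfS : aeval (Xg k) f ∈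
            TwoSidedIdeal.span {1 - Xg k * Yg k, aeval (Xg k) f} :=
          TwoSidedIdeal.subset_span (by simp)
        obtain ⟨n, p, h⟩ := exists_mul_pow a
        apply mem_of_mul_pow _ heS a n
        have hp : p ∈ Q := (hQ p).2 (h ▸ P.mul_mem_right _ _ ha)
        rw [hgf, Ideal.mem_span_singleton] at hp
        obtain ⟨q, rfl⟩ := hp
        rw [h, map_mul]
        exact TwoSidedIdeal.mul_mem_right _ _ _ hfS
      · rw [TwoSidedIdeal.span_le]
        rintro a (rfl | rfl)
        · exact he
        · exact hfQ

end helpers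

open Polynomial in
/-- the prime two-sided ideals of `R` (a proper two-sided ideal `P` is
prime when `I J ⊆ P` implies `I ⊆ P` or `J ⊆ P` for all two-sided ideals `I`, `J`)
are exactly: `0`, `F = ⟨1 − xy⟩`, and the maximal ideals `⟨1 − xy, f(x)⟩` with `f`
monic irreducible and not a monomial. -/
theorem prime_ideal_classification (k : Type) [Field k] (P : TwoSidedIdeal (R k)) :
    (P ≠ ⊤ ∧ ∀ I J : TwoSidedIdeal (R k),
        (∀ a ∈ I, ∀ b ∈ J, a * b ∈ P) → I ≤ P ∨ J ≤ P) ↔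
      (P = ⊥ ∨ P = Fideal k ∨
        ∃ f : k[X], f.Monic ∧ Irreducible f ∧ (∀ n : ℕ, f ≠ X ^ n) ∧
          P = TwoSidedIdeal.span {1 - Xg k * Yg k, aeval (Xg k) f}) := by
  constructor
  · rintro ⟨hT, hP⟩
    by_cases hb : P = ⊥
    · exact Or.inl hb
    · right
      apply classify P hT hP
      have : ¬ P ≤ ⊥ := fun h => hb (le_bot_iff.1 h)
      obtain ⟨a, ha, ha'⟩ := SetLike.not_le_iff_exists.mp this
      exact e_mem P a (fun h => ha' (TwoSidedIdeal.mem_bot _ |>.2 h)) ha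
  · rintro (rfl | rfl | ⟨f, hm, hirr, hX, rfl⟩)
    · constructor
      · intro h
        apply e_ne_zero (k := k)
        rw [← TwoSidedIdeal.mem_bot, h]
        exact TwoSidedIdeal.mem_top _
      · intro I J h
        by_contra! hc
        obtain ⟨a, ha, ha'⟩ := SetLike.not_le_iff_exists.mp hc.1
        obtain ⟨b, hb, hb'⟩ := SetLike.not_le_iff_exists.mp hc.2
        have h1 := e_mem I a (fun h => ha' (TwoSidedIdeal.mem_bot _ |>.2 h)) ha
        have h2 := e_mem J b (fun h => hb' (TwoSidedIdeal.mem_bot _ |>.2 h)) hb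
        have h3 := h _ h1 _ h2
        rw [e_e, TwoSidedIdeal.mem_bot] at h3
        exact e_ne_zero h3
    · apply prime_of_hom (K := FractionRing k[X]) (algebraMap k[X] _ X)
      · simp
      · exact TwoSidedIdeal.subset_span rfl
      · intro p hp
        rw [aeval_algebraMap_apply, aeval_X_left_apply] at hp
        have : p = 0 := by simpa using hp
        rw [this, map_zero]
        exact TwoSidedIdeal.zero_mem _
      · intro φ _ he
        exact span_le_ker φ.toRingHom _ (by rintro a rfl; exact he)
    · have := Fact.mk hirr
      apply prime_of_hom (K := AdjoinRoot f) (AdjoinRoot.root f)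
      · intro h0
        have h1 : f ∣ X := by
          rw [← AdjoinRoot.mk_eq_zero, AdjoinRoot.mk_X, h0]
        have h2 : Associated f X := hirr.associated_of_dvd irreducible_X h1
        exact hX 1 (by rw [pow_one]; exact eq_of_monic_of_associated hm monic_X h2)
      · exact TwoSidedIdeal.subset_span (by simp)
      · intro p hp
        rw [AdjoinRoot.aeval_eq, AdjoinRoot.mk_eq_zero] at hp
        obtain ⟨q, rfl⟩ := hp
        rw [map_mul]
        exact TwoSidedIdeal.mul_mem_right _ _ _ (TwoSidedIdeal.subset_span (by simp))
      · intro φ hx he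
        refine span_le_ker φ.toRingHom _ ?_
        rintro a (rfl | rfl)
        · exact he
        · change φ _ = 0
          rw [← aeval_algHom_apply, hx, AdjoinRoot.aeval_eq, AdjoinRoot.mk_self]
end
end
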